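/- Let 0 < α ≤ 1. Then the function x ↦ E_α(-x) on [0,∞) satisfies: E_α(0) = 1; E_α(-x) > 0 for every x ≥ 0; E_α(-x) is nonincreasing in x on [0,∞); and lim_{x → ∞} E_α(-x) = 0. In particular, for any real symmetric positive semidefinite matrix A and any t ≥ 0, the matrix E_α(-A t^α) has all eigenvalues in (0,1] and is therefore invertible. -/

import Mathlib

open Matrix Filter Set

/-- The Mittag-Leffler function `E_α(x) = ∑_{j=0}^∞ x^j / Γ(α j + 1)`. -/
noncomputable def mittagLeffler (α x : ℝ) : ℝ :=
  ∑' j : ℕ, x ^ j / Real.Gamma (α * j + 1)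

/-- The matrix Mittag-Leffler function `E_α(B) = ∑_{j=0}^∞ B^j / Γ(α j + 1)`. -/
noncomputable def mittagLefflerMatrix {n : ℕ} (α : ℝ) (B : Matrix (Fin n) (Fin n) ℝ) :
    Matrix (Fin n) (Fin n) ℝ :=
  ∑' j : ℕ, (Real.Gamma (α * j + 1))⁻¹ • B ^ j


noncomputable def mlB (s : ℝ) (n : ℕ) : ℝ := ∏ k ∈ Finset.range n, (s + k) / (k + 1)

lemma mlB_zero (s : ℝ) : mlB s 0 = 1 := by simp [mlB]

lemma mlB_succ (s : ℝ) (n : ℕ) : mlB s (n + 1) = mlB s n * ((s + n) / (n + 1)) := by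
  simp only [mlB, Finset.prod_range_succ]

lemma mlB_eq_choose (s : ℝ) (n : ℕ) : mlB s n = (-1) ^ n * Ring.choose (-s) n := by
  induction n with
  | zero => simp [mlB_zero]
  | succ n ih =>
    have h := Ring.choose_smul_choose (-s) (Nat.le_succ n)
    simp only [Nat.succ_eq_add_one, Nat.choose_succ_self_right, add_tsub_cancel_left,
      Ring.choose_one_right, nsmul_eq_mul] at h
    push_cast at h
    rw [mlB_succ, ih]
    have hn : (n : ℝ) + 1 ≠ 0 := by positivity
    field_simp
    rw [pow_succ]
    linear_combination (-1) ^ n * h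

lemma mlB_add (s t : ℝ) (n : ℕ) :
    mlB (s + t) n = ∑ ij ∈ Finset.HasAntidiagonal.antidiagonal n, mlB s ij.1 * mlB t ij.2 := by
  rw [mlB_eq_choose, neg_add, Ring.add_choose_eq n (Commute.all _ _), Finset.mul_sum]
  refine Finset.sum_congr rfl fun ij hij => ?_
  rw [mlB_eq_choose, mlB_eq_choose, ← Finset.HasAntidiagonal.mem_antidiagonal.1 hij, pow_add]
  ring

lemma mlB_nonneg {s : ℝ} (hs : 0 ≤ s) (n : ℕ) : 0 ≤ mlB s n :=
  Finset.prod_nonneg fun k _ => by positivity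

lemma mlB_neg {α : ℝ} (h0 : 0 < α) (h1 : α ≤ 1) (n : ℕ) : mlB (-α) (n + 1) ≤ 0 := by
  induction n with
  | zero => simp [mlB]; exact h0.le
  | succ n ih =>
    rw [mlB_succ]
    apply mul_nonpos_of_nonpos_of_nonneg ih
    apply div_nonneg _ (by positivity)
    push_cast
    have : (0 : ℝ) ≤ n := by positivity
    linarith

lemma mlB_one (n : ℕ) : mlB 1 n = 1 := by
  apply Finset.prod_eq_one
  intro k _
  have : (k : ℝ) + 1 ≠ 0 := by positivity
  field_simp
  ring

lemma mlB_zero_left (n : ℕ) : mlB 0 (n + 1) = 0 := by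
  induction n with
  | zero => simp [mlB]
  | succ n ih => rw [mlB_succ, ih, zero_mul]

lemma mlB_neg_one (n : ℕ) : mlB (-1) (n + 2) = 0 := by
  induction n with
  | zero => norm_num [mlB, Finset.prod_range_succ]
  | succ n ih => rw [mlB_succ, ih, zero_mul]

noncomputable def mlL (s : ℝ) : PowerSeries ℝ := PowerSeries.mk (mlB s)

lemma mlL_mul (s t : ℝ) : mlL s * mlL t = mlL (s + t) := by
  ext n
  simp [mlL, PowerSeries.coeff_mul, mlB_add]

lemma mlL_zero : mlL 0 = 1 := by
  ext n
  cases n with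
  | zero => simp [mlL, mlB_zero]
  | succ n => simp [mlL, mlB_zero_left, PowerSeries.coeff_one]

lemma mlL_neg_one : mlL (-1) = 1 - PowerSeries.X := by
  ext n
  match n with
  | 0 => simp [mlL, mlB_zero]
  | 1 => simp [mlL, mlB, PowerSeries.coeff_one]
  | n + 2 => simp [mlL, mlB_neg_one, PowerSeries.coeff_one, PowerSeries.coeff_X]

lemma ml_nonneg_of_mul {W D R : PowerSeries ℝ} (h : W * D = R)
    (hD0 : 0 < D.coeff 0) (hD : ∀ n, D.coeff (n + 1) ≤ 0) (hR : ∀ n, 0 ≤ R.coeff n) (n : ℕ) :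
    0 ≤ W.coeff n := by
  induction n using Nat.strong_induction_on with
  | _ n ih =>
    have h1 : R.coeff n = _ := (congrArg (fun z => z.coeff n) h.symm).trans (PowerSeries.coeff_mul ..)
    rw [Finset.Nat.sum_antidiagonal_eq_sum_range_succ (fun i j => W.coeff i * D.coeff j),
      Finset.sum_range_succ, Nat.sub_self] at h1
    have h2 : ∑ k ∈ Finset.range n, W.coeff k * D.coeff (n - k) ≤ 0 := by
      apply Finset.sum_nonpos
      intro k hk
      have hk := Finset.mem_range.1 hk
      obtain ⟨m, hm⟩ : ∃ m, n - k = m + 1 := ⟨n - k - 1, by omega⟩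
      rw [hm]
      exact mul_nonpos_of_nonneg_of_nonpos (ih k hk) (hD m)
    have h3 : 0 ≤ W.coeff n * D.coeff 0 := by linarith [hR n]
    exact nonneg_of_mul_nonneg_left h3 hD0

/-- the abstract discrete resolvent facts -/
lemma ml_discrete {α q : ℝ} (h0 : 0 < α) (h1 : α ≤ 1) (hq : 0 ≤ q) (u : ℕ → ℝ)
    (hu : ∀ n, u n + q * ∑ ij ∈ Finset.HasAntidiagonal.antidiagonal n, u ij.1 * mlB α ij.2 = 1) :
    (∀ n, 0 ≤ u n) ∧ Antitone u ∧ ∀ n, u n * (1 + q * mlB (α + 1) n) ≤ 1 := by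
  set U : PowerSeries ℝ := PowerSeries.mk u with hU
  have e1 : U * (1 + PowerSeries.C q * mlL α) = mlL 1 := by
    ext n
    have : U * (1 + PowerSeries.C q * mlL α) = U + PowerSeries.C q * (U * mlL α) := by ring
    rw [this, map_add, PowerSeries.coeff_C_mul, PowerSeries.coeff_mul]
    simpa [U, mlL, mlB_one] using hu n
  have e2 : U * (mlL (-α) + PowerSeries.C q) = mlL (1 - α) := by
    have h := congrArg (fun z => z * mlL (-α)) e1
    beta_reduce at h
    have h3 : mlL α * mlL (-α) = 1 := by rw [mlL_mul, add_neg_cancel, mlL_zero]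
    rw [mlL_mul, ← sub_eq_add_neg] at h
    rw [← h]
    linear_combination (- U * PowerSeries.C q) * h3
  have e3 : (1 - mlL (-1) * U) * (mlL (-α) + PowerSeries.C q) = PowerSeries.C q := by
    have h3 : mlL (-1) * mlL (1 - α) = mlL (-α) := by rw [mlL_mul]; congr 1; ring
    linear_combination (- mlL (-1)) * e2 - h3
  have hD0 : 0 < (mlL (-α) + PowerSeries.C q).coeff 0 := by
    simp [mlL, mlB_zero]; linarith
  have hD : ∀ n, (mlL (-α) + PowerSeries.C q).coeff (n + 1) ≤ 0 := by
    intro n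
    simpa [mlL, PowerSeries.coeff_C] using mlB_neg h0 h1 n
  have p1 : ∀ n, 0 ≤ u n := by
    intro n
    have := ml_nonneg_of_mul e2 hD0 hD
      (fun n => by simpa [mlL] using mlB_nonneg (by linarith) n) n
    simpa [U] using this
  have p2 : Antitone u := by
    apply antitone_nat_of_succ_le
    intro n
    have := ml_nonneg_of_mul e3 hD0 hD
      (fun n => by rw [PowerSeries.coeff_C]; split_ifs <;> simp [hq]) (n + 1)
    rw [mlL_neg_one, sub_mul, one_mul, map_sub, map_sub, PowerSeries.coeff_succ_X_mul] at this
    simp [U, PowerSeries.coeff_one] at this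
    linarith
  refine ⟨p1, p2, fun n => ?_⟩
  have h := hu n
  have hs : mlB (α + 1) n = ∑ ij ∈ Finset.HasAntidiagonal.antidiagonal n, mlB α ij.2 := by
    rw [add_comm, mlB_add]
    simp [mlB_one]
  have : u n * mlB (α + 1) n ≤ ∑ ij ∈ Finset.HasAntidiagonal.antidiagonal n, u ij.1 * mlB α ij.2 := by
    rw [hs, Finset.mul_sum]
    apply Finset.sum_le_sum
    intro ij hij
    apply mul_le_mul_of_nonneg_right _ (mlB_nonneg h0.le _)
    apply p2
    have := Finset.HasAntidiagonal.mem_antidiagonal.1 hij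
    omega
  nlinarith [mul_le_mul_of_nonneg_left this hq]

lemma mlB_nat (m n : ℕ) : mlB (m + 1) n = ((m + n).choose n : ℝ) := by
  induction n with
  | zero => simp [mlB_zero]
  | succ n ih =>
    rw [mlB_succ, ih]
    have h := Nat.add_one_mul_choose_eq (m + n) n
    have h' : ((m : ℝ) + n + 1) * ((m + n).choose n : ℝ) =
        ((m + n + 1).choose (n + 1) : ℝ) * (n + 1) := by exact_mod_cast h
    have hn : (n : ℝ) + 1 ≠ 0 := by positivity
    rw [← add_assoc]
    field_simp
    linear_combination h'

lemma mlB_nat_le (m n : ℕ) (c : ℝ) (hc : 0 < c) (hn : c ≤ n) :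
    mlB (m + 1) n ≤ Real.exp c * (2 * n / c) ^ m := by
  have hn0 : (0 : ℝ) < n := lt_of_lt_of_le hc hn
  rw [mlB_nat]
  have h1 : (c / n) ^ m * ((m + n).choose n : ℝ) ≤ (c / n + 1) ^ (m + n) := by
    rw [add_pow, Nat.choose_symm_add.symm]
    refine le_trans (le_of_eq ?_) (Finset.single_le_sum
      (f := fun k => (c / (n : ℝ)) ^ k * 1 ^ (m + n - k) * ((m + n).choose k : ℝ))
      (fun k _ => by positivity) (Finset.mem_range.2 (show m < m + n + 1 by omega)))
    simp
  have h2 : (c / n + 1) ^ n ≤ Real.exp c := by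
    calc (c / n + 1) ^ n ≤ (Real.exp (c / n)) ^ n :=
          pow_le_pow_left₀ (by positivity) (Real.add_one_le_exp _) n
      _ = Real.exp c := by
          rw [← Real.exp_nat_mul]; congr 1; field_simp
  have h3 : (c / n + 1) ^ m ≤ 2 ^ m := by
    apply pow_le_pow_left₀ (by positivity)
    have : c / n ≤ 1 := (div_le_one hn0).2 hn
    linarith
  have h4 : (c / n) ^ m * ((m + n).choose n : ℝ) ≤ 2 ^ m * Real.exp c := by
    rw [pow_add] at h1
    exact h1.trans (mul_le_mul h3 h2 (by positivity) (by positivity))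
  have h5 : (2 * n / c) ^ m * (c / n) ^ m = 2 ^ m := by
    rw [← mul_pow]; congr 1; field_simp
  have h6 : 0 < (c / n) ^ m := by positivity
  rw [← mul_le_mul_iff_right₀ h6]
  refine h4.trans (le_of_eq ?_)
  linear_combination (- Real.exp c) * h5

lemma mlB_theta_le (θ : ℝ) (h0 : 0 ≤ θ) (h1 : θ ≤ 1) (n : ℕ) (hn : 0 < n) :
    mlB (θ + 1) n ≤ Real.exp 1 * (n : ℝ) ^ θ := by
  have hn' : (0 : ℝ) < n := by exact_mod_cast hn
  have hH := harmonic_le_one_add_log n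
  calc mlB (θ + 1) n ≤ ∏ k ∈ Finset.range n, Real.exp (θ * ((k : ℝ) + 1)⁻¹) := by
        apply Finset.prod_le_prod
        · intro k _; positivity
        · intro k _
          refine le_trans (le_of_eq ?_) (Real.add_one_le_exp _)
          have : (k : ℝ) + 1 ≠ 0 := by positivity
          field_simp
          ring
    _ = Real.exp (θ * (harmonic n : ℝ)) := by
        rw [← Real.exp_sum, ← Finset.mul_sum]
        simp [harmonic]
    _ ≤ Real.exp (1 + Real.log n * θ) := by
        apply Real.exp_le_exp.2
        nlinarith [mul_le_mul_of_nonneg_left hH h0]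
    _ = _ := by rw [Real.exp_add, Real.rpow_def_of_pos hn']

lemma mlB_mul_le (a b : ℝ) (ha : 0 ≤ a) (hb : 0 ≤ b) (n : ℕ) :
    mlB (a + b + 1) n ≤ mlB (a + 1) n * mlB (b + 1) n := by
  unfold mlB
  rw [← Finset.prod_mul_distrib]
  apply Finset.prod_le_prod
  · intro k _; positivity
  · intro k _
    have hk : (0 : ℝ) < (k : ℝ) + 1 := by positivity
    rw [div_mul_div_comm, div_le_div_iff₀ hk (by positivity)]
    have : 0 ≤ (k + 1 : ℝ) * (a * b) := by positivity
    nlinarith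

lemma mlB_le (s : ℝ) (hs : 0 ≤ s) (c : ℝ) (hc : 2 ≤ c) (n : ℕ) (hn : c ≤ n) :
    mlB (s + 1) n ≤ (Real.exp c * Real.exp 1 * (c / 2)) * ((n : ℝ) ^ s * (2 / c) ^ s) := by
  have hc0 : 0 < c := by linarith
  have hn0 : (0 : ℝ) < n := by linarith
  set m := ⌊s⌋₊ with hm
  have hms : (m : ℝ) ≤ s := Nat.floor_le hs
  have hms' : s < m + 1 := Nat.lt_floor_add_one s
  have h1 := mlB_mul_le m (s - m) (by positivity) (by linarith) n
  rw [add_sub_cancel] at h1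
  have h2 := mlB_nat_le m n c hc0 hn
  have h3 := mlB_theta_le (s - m) (by linarith) (by linarith) n (by exact_mod_cast hn0)
  have h4 : (2 / c) ^ m ≤ (2 / c) ^ s * (c / 2) := by
    have h5 : (2 / c) ^ (m : ℝ) ≤ (2 / c) ^ (s - 1) :=
      Real.rpow_le_rpow_of_exponent_ge (by positivity) ((div_le_one hc0).2 hc) (by linarith)
    rw [Real.rpow_natCast, Real.rpow_sub (by positivity), Real.rpow_one] at h5
    refine h5.trans (le_of_eq ?_)
    field_simp
  have h6 : (n : ℝ) ^ s = (n : ℝ) ^ m * (n : ℝ) ^ (s - m) := by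
    rw [← Real.rpow_natCast, ← Real.rpow_add hn0]; congr 1; ring
  calc mlB (s + 1) n ≤ _ := h1
    _ ≤ (Real.exp c * (2 * n / c) ^ m) * (Real.exp 1 * (n : ℝ) ^ (s - m)) :=
        mul_le_mul h2 h3 (mlB_nonneg (by linarith) _) (by positivity)
    _ = Real.exp c * Real.exp 1 * (n : ℝ) ^ s * (2 / c) ^ m := by
        rw [h6, show 2 * (n : ℝ) / c = n * (2 / c) by ring, mul_pow]; ring
    _ ≤ Real.exp c * Real.exp 1 * (n : ℝ) ^ s * ((2 / c) ^ s * (c / 2)) :=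
        mul_le_mul_of_nonneg_left h4 (by positivity)
    _ = _ := by ring

lemma ml_dom (α : ℝ) (hα : 0 < α) (X : ℝ) (hX : 0 < X) :
    ∃ (K : ℝ) (N : ℕ), ∀ n ≥ N, ∀ q : ℝ, 0 ≤ q → q * (n : ℝ) ^ α ≤ X → ∀ j : ℕ,
      q ^ j * mlB (α * j + 1) n ≤ K * (1 / 2) ^ j := by
  set c := max 2 (2 * (2 * X) ^ (1 / α)) with hc
  have hc2 : 2 ≤ c := le_max_left _ _
  have hc0 : 0 < c := by linarith
  have hcX : X * (2 / c) ^ α ≤ 1 / 2 := by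
    have h1 : 2 * (2 * X) ^ (1 / α) ≤ c := le_max_right _ _
    have h2 : ((2 * X) ^ (1 / α)) ^ α ≤ (c / 2) ^ α :=
      Real.rpow_le_rpow (by positivity) (by linarith) hα.le
    rw [← Real.rpow_mul (by positivity), one_div_mul_cancel hα.ne', Real.rpow_one] at h2
    have h3 : (2 / c) ^ α * (c / 2) ^ α = 1 := by
      rw [← Real.mul_rpow (by positivity) (by positivity)]
      rw [show 2 / c * (c / 2) = 1 by field_simp, Real.one_rpow]
    have h4 : 0 < (2 / c) ^ α := by positivity
    nlinarith [mul_le_mul_of_nonneg_left h2 h4.le]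
  refine ⟨Real.exp c * Real.exp 1 * (c / 2), ⌈c⌉₊, fun n hn q hq hqX j => ?_⟩
  have hcn : c ≤ n := (Nat.le_ceil c).trans (by exact_mod_cast hn)
  have hn0 : (0 : ℝ) < n := by linarith
  have h := mlB_le (α * j) (by positivity) c hc2 n hcn
  calc q ^ j * mlB (α * j + 1) n ≤ q ^ j * _ := mul_le_mul_of_nonneg_left h (by positivity)
    _ = (Real.exp c * Real.exp 1 * (c / 2)) * (q * (n : ℝ) ^ α * (2 / c) ^ α) ^ j := by
        rw [Real.rpow_mul hn0.le, Real.rpow_mul (by positivity), Real.rpow_natCast,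
          Real.rpow_natCast, mul_pow, mul_pow]
        ring
    _ ≤ _ := by
        apply mul_le_mul_of_nonneg_left _ (by positivity)
        apply pow_le_pow_left₀ (by positivity)
        exact (mul_le_mul_of_nonneg_right hqX (by positivity)).trans hcX

lemma mlB_tendsto (s : ℝ) (hs : 0 ≤ s) :
    Tendsto (fun n : ℕ => mlB (s + 1) n / (n : ℝ) ^ s) atTop (nhds (Real.Gamma (s + 1))⁻¹) := by
  have hG := Real.GammaSeq_tendsto_Gamma (s + 1)
  have h1 : Tendsto (fun n : ℕ => (n : ℝ) / ((n : ℝ) + (s + 1))) atTop (nhds 1) :=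
    tendsto_natCast_div_add_atTop (s + 1)
  have h2 := h1.mul (hG.inv₀ (Real.Gamma_pos_of_pos (by linarith)).ne')
  rw [one_mul] at h2
  refine h2.congr' ?_
  filter_upwards [eventually_gt_atTop 0] with n hn
  have hn0 : (0 : ℝ) < n := by exact_mod_cast hn
  have hp : ∏ j ∈ Finset.range n, (s + 1 + j) = mlB (s + 1) n * (n.factorial : ℝ) := by
    unfold mlB
    rw [Finset.prod_div_distrib, ← Finset.prod_range_add_one_eq_factorial]
    push_cast
    rw [div_mul_cancel₀]
    exact Finset.prod_ne_zero_iff.2 fun k _ => by positivity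
  have hb : 0 < mlB (s + 1) n := Finset.prod_pos fun k _ => by positivity
  have hf : (0 : ℝ) < n.factorial := by positivity
  have hns : 0 < (n : ℝ) ^ s := by positivity
  have h3 : s + 1 + (n : ℝ) ≠ 0 := by positivity
  have h3' : (n : ℝ) + (s + 1) ≠ 0 := by positivity
  rw [Real.GammaSeq, Finset.prod_range_succ, hp, Real.rpow_add hn0, Real.rpow_one]
  field_simp
  ring

lemma ml_term_tendsto (α : ℝ) (hα : 0 < α) (x : ℝ) (m : ℕ → ℕ) (hm : Tendsto m atTop atTop)
    (q : ℕ → ℝ) (hqx : Tendsto (fun i => q i * (m i : ℝ) ^ α) atTop (nhds x)) (j : ℕ) :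
    Tendsto (fun i => (q i) ^ j * mlB (α * j + 1) (m i)) atTop
      (nhds (x ^ j / Real.Gamma (α * j + 1))) := by
  have h1 := (mlB_tendsto (α * j) (by positivity)).comp hm
  have h2 := (hqx.pow j).mul h1
  rw [← div_eq_mul_inv] at h2
  refine h2.congr' ?_
  filter_upwards [hm.eventually_gt_atTop 0] with i hi
  have hn0 : (0 : ℝ) < m i := by exact_mod_cast hi
  have : 0 < (m i : ℝ) ^ α := by positivity
  simp only [Function.comp]
  rw [Real.rpow_mul hn0.le, Real.rpow_natCast, mul_pow]
  field_simp

lemma ml_q_tendsto (α : ℝ) (x : ℝ) :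
    Tendsto (fun i : ℕ => x / (i : ℝ) ^ α * (i : ℝ) ^ α) atTop (nhds x) := by
  refine tendsto_const_nhds.congr' ?_
  filter_upwards [eventually_gt_atTop 0] with i hi
  have hn0 : (0 : ℝ) < i := by exact_mod_cast hi
  have : 0 < (i : ℝ) ^ α := by positivity
  field_simp

lemma ml_coeff_bound (α : ℝ) (hα : 0 < α) (X : ℝ) (hX : 0 < X) :
    ∃ K : ℝ, ∀ j : ℕ, X ^ j / Real.Gamma (α * j + 1) ≤ K * (1 / 2) ^ j := by
  obtain ⟨K, N, h⟩ := ml_dom α hα X hX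
  refine ⟨K, fun j => ?_⟩
  refine le_of_tendsto (ml_term_tendsto α hα X id tendsto_id _ (ml_q_tendsto α X) j) ?_
  filter_upwards [eventually_ge_atTop N, eventually_gt_atTop 0] with n hn hn'
  have hn0 : (0 : ℝ) < n := by exact_mod_cast hn'
  refine h n hn _ (by positivity) (le_of_eq ?_) j
  have : 0 < (n : ℝ) ^ α := by positivity
  field_simp

lemma ml_summable (α : ℝ) (hα : 0 < α) (x : ℝ) :
    Summable fun j : ℕ => x ^ j / Real.Gamma (α * j + 1) := by
  obtain ⟨K, h⟩ := ml_coeff_bound α hα (|x| + 1) (by positivity)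
  refine Summable.of_norm_bounded
    ((summable_geometric_of_lt_one (r := (1 / 2 : ℝ)) (by norm_num) (by norm_num)).mul_left K) fun j => ?_
  have hG : 0 < Real.Gamma (α * j + 1) := Real.Gamma_pos_of_pos (by positivity)
  rw [norm_div, norm_pow, Real.norm_eq_abs, Real.norm_eq_abs, abs_of_pos hG]
  refine le_trans ?_ (h j)
  gcongr
  linarith

lemma ml_summable_disc (α q : ℝ) (h0 : 0 < α) (h1 : α ≤ 1) (hq : 0 ≤ q) (hq1 : q < 1) (n : ℕ) :
    Summable fun j : ℕ => (-q) ^ j * mlB (α * j + 1) n := by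
  have s1 : Summable fun j : ℕ => 2 ^ n * ((j : ℝ) ^ n * q ^ j) + q ^ j := by
    have hq' : ‖q‖ < 1 := by rwa [Real.norm_eq_abs, abs_of_nonneg hq]
    have s2 : Summable fun j : ℕ => (j : ℝ) ^ n * q ^ j :=
      summable_pow_mul_geometric_of_norm_lt_one n hq'
    exact (s2.mul_left _).add (summable_geometric_of_lt_one hq hq1)
  refine Summable.of_norm_bounded s1 fun j => ?_
  have hb : mlB (α * j + 1) n ≤ ((j : ℝ) + 1) ^ n := by
    have hh : ∏ k ∈ Finset.range n, ((j : ℝ) + 1) = ((j : ℝ) + 1) ^ n := by simp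
    rw [← hh]
    apply Finset.prod_le_prod
    · intro k _; positivity
    · intro k _
      have hk : (0 : ℝ) ≤ k := by positivity
      have hj : (0 : ℝ) ≤ j := by positivity
      rw [div_le_iff₀ (by positivity)]
      nlinarith [mul_nonneg hk hj, mul_nonneg hj (sub_nonneg.2 h1)]
  have hb2 : ((j : ℝ) + 1) ^ n ≤ 2 ^ n * (j : ℝ) ^ n + 1 := by
    rcases Nat.eq_zero_or_pos j with rfl | hj
    · have : (0 : ℝ) ≤ 2 ^ n * 0 ^ n := by positivity
      simpa using this
    · have hj' : (1 : ℝ) ≤ j := by exact_mod_cast hj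
      rw [← mul_pow]
      have : ((j : ℝ) + 1) ^ n ≤ (2 * j) ^ n := pow_le_pow_left₀ (by positivity) (by linarith) n
      linarith
  rw [norm_mul, norm_pow, norm_neg, Real.norm_eq_abs, Real.norm_eq_abs, abs_of_nonneg hq,
    abs_of_nonneg (mlB_nonneg (by positivity) n)]
  have hqj : 0 ≤ q ^ j := by positivity
  nlinarith [mul_le_mul_of_nonneg_left (hb.trans hb2) hqj]

noncomputable def mlU (α q : ℝ) (n : ℕ) : ℝ := ∑' j : ℕ, (-q) ^ j * mlB (α * j + 1) n

lemma mlU_props (α q : ℝ) (h0 : 0 < α) (h1 : α ≤ 1) (hq : 0 ≤ q) (hq1 : q < 1) :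
    (∀ n, 0 ≤ mlU α q n) ∧ Antitone (mlU α q) ∧
      ∀ n, mlU α q n * (1 + q * mlB (α + 1) n) ≤ 1 := by
  apply ml_discrete h0 h1 hq
  intro n
  have hs := ml_summable_disc α q h0 h1 hq hq1
  have e1 : ∑ ij ∈ Finset.HasAntidiagonal.antidiagonal n, mlU α q ij.1 * mlB α ij.2 =
      ∑' j : ℕ, (-q) ^ j * mlB (α * (j + 1) + 1) n := by
    refine (HasSum.tsum_eq ?_).symm
    have h := hasSum_sum (s := Finset.HasAntidiagonal.antidiagonal n)
      (fun ij _ => ((hs ij.1).hasSum.mul_right (mlB α ij.2)))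
    refine h.congr_fun ?_
    intro j
    rw [show α * ((j : ℝ) + 1) + 1 = (α * j + 1) + α by ring, mlB_add, Finset.mul_sum]
    exact Finset.sum_congr rfl fun _ _ => by ring
  rw [e1, mlU, (hs n).tsum_eq_zero_add, ← tsum_mul_left, add_assoc, ← Summable.tsum_add]
  · have : ∀ j : ℕ, (-q) ^ (j + 1) * mlB (α * ((j + 1 : ℕ) : ℝ) + 1) n +
        q * ((-q) ^ j * mlB (α * (j + 1) + 1) n) = 0 := by
      intro j; push_cast; ring
    simp only [this, tsum_zero]
    simp [mlB_one]
  · exact (summable_nat_add_iff 1).2 (hs n)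
  · have := ((summable_nat_add_iff 1).2 (hs n)).neg
    refine this.congr fun j => ?_
    push_cast; ring

lemma mlU_tendsto (α : ℝ) (hα : 0 < α) (x : ℝ) (hx : 0 ≤ x) (m : ℕ → ℕ)
    (hm : Tendsto m atTop atTop) (q : ℕ → ℝ) (hq : ∀ i, 0 ≤ q i)
    (hqx : Tendsto (fun i => q i * (m i : ℝ) ^ α) atTop (nhds x)) :
    Tendsto (fun i => mlU α (q i) (m i)) atTop (nhds (mittagLeffler α (-x))) := by
  obtain ⟨K, N, h⟩ := ml_dom α hα (x + 1) (by positivity)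
  refine tendsto_tsum_of_dominated_convergence (bound := fun j : ℕ => K * (1 / 2) ^ j)
    ((summable_geometric_of_lt_one (by norm_num) (by norm_num)).mul_left K) ?_ ?_
  · intro j
    have := ml_term_tendsto α hα (-x) m hm (fun i => - q i) (by simpa using hqx.neg) j
    exact this
  · filter_upwards [hm.eventually_ge_atTop N, hqx.eventually_le_const (lt_add_one x)] with i hi hi' j
    rw [norm_mul, norm_pow, norm_neg, Real.norm_eq_abs, Real.norm_eq_abs, abs_of_nonneg (hq i),
      abs_of_nonneg (mlB_nonneg (by positivity) _)]
    exact h _ hi _ (hq i) hi' j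

lemma ml_q_small (α : ℝ) (hα : 0 < α) (x : ℝ) : ∀ᶠ i : ℕ in atTop, x / (i : ℝ) ^ α < 1 := by
  have : Tendsto (fun i : ℕ => x / (i : ℝ) ^ α) atTop (nhds 0) :=
    ((tendsto_rpow_atTop hα).comp tendsto_natCast_atTop_atTop).const_div_atTop x
  exact this.eventually_lt_const one_pos

lemma ml_nonneg_decay (α : ℝ) (hα : 0 < α) (h1 : α ≤ 1) (x : ℝ) (hx : 0 ≤ x) :
    0 ≤ mittagLeffler α (-x) ∧
      mittagLeffler α (-x) * (1 + x / Real.Gamma (α + 1)) ≤ 1 := by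
  have ht := mlU_tendsto α hα x hx id tendsto_id (fun i => x / (i : ℝ) ^ α)
    (fun i => by positivity) (ml_q_tendsto α x)
  have ht2 := ml_term_tendsto α hα x id tendsto_id (fun i => x / (i : ℝ) ^ α) (ml_q_tendsto α x) 1
  simp only [pow_one, Nat.cast_one, mul_one] at ht2
  constructor
  · refine ge_of_tendsto ht ?_
    filter_upwards [ml_q_small α hα x] with i hi
    exact (mlU_props α _ hα h1 (by positivity) hi).1 _
  · refine le_of_tendsto (ht.mul (ht2.const_add 1)) ?_
    filter_upwards [ml_q_small α hα x] with i hi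
    exact (mlU_props α _ hα h1 (by positivity) hi).2.2 _

lemma ml_zero (α : ℝ) : mittagLeffler α 0 = 1 := by
  unfold mittagLeffler
  rw [tsum_eq_single 0]
  · simp
  · intro j hj; simp [hj]

lemma ml_le_one (α : ℝ) (hα : 0 < α) (h1 : α ≤ 1) (x : ℝ) (hx : 0 ≤ x) :
    mittagLeffler α (-x) ≤ 1 := by
  obtain ⟨h2, h3⟩ := ml_nonneg_decay α hα h1 x hx
  have hG : 0 < Real.Gamma (α + 1) := Real.Gamma_pos_of_pos (by positivity)
  have : 0 ≤ mittagLeffler α (-x) * (x / Real.Gamma (α + 1)) := by positivity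
  linarith

lemma ml_antitone (α : ℝ) (hα : 0 < α) (h1 : α ≤ 1) :
    AntitoneOn (fun x : ℝ => mittagLeffler α (-x)) (Ici 0) := by
  intro x hx y hy hxy
  have hx : 0 ≤ x := hx
  beta_reduce
  rcases hx.eq_or_lt with rfl | hx0
  · rw [neg_zero, ml_zero]
    exact ml_le_one α hα h1 y hy
  set ρ := (y / x) ^ (1 / α) with hρ
  have hyx : 1 ≤ y / x := (one_le_div hx0).2 hxy
  have hρ1 : 1 ≤ ρ := Real.one_le_rpow hyx (by positivity)
  have hρα : ρ ^ α = y / x := by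
    rw [hρ, ← Real.rpow_mul (by positivity), one_div_mul_cancel hα.ne', Real.rpow_one]
  have hm : ∀ n : ℕ, n ≤ ⌈ρ * n⌉₊ := by
    intro n
    have h2 : (n : ℝ) ≤ ρ * n := by
      have : (0 : ℝ) ≤ n := by positivity
      nlinarith
    exact_mod_cast h2.trans (Nat.le_ceil _)
  have ht := mlU_tendsto α hα x hx id tendsto_id (fun i => x / (i : ℝ) ^ α)
    (fun i => by positivity) (ml_q_tendsto α x)
  have ht2 := mlU_tendsto α hα y hy (fun n => ⌈ρ * n⌉₊) (tendsto_atTop_mono hm tendsto_id)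
    (fun i => x / (i : ℝ) ^ α) (fun i => by positivity) (by
      have h3 : Tendsto (fun n : ℕ => (⌈ρ * n⌉₊ : ℝ) / (n : ℝ)) atTop (nhds ρ) :=
        (tendsto_nat_ceil_mul_div_atTop (R := ℝ) (by linarith)).comp tendsto_natCast_atTop_atTop
      have h4 := (h3.rpow_const (p := α) (Or.inr hα.le)).const_mul x
      rw [hρα, mul_div_cancel₀ _ hx0.ne'] at h4
      refine h4.congr fun n => ?_
      rw [Real.div_rpow (by positivity) (by positivity)]
      ring)
  refine le_of_tendsto_of_tendsto ht2 ht ?_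
  filter_upwards [ml_q_small α hα x] with i hi
  exact (mlU_props α _ hα h1 (by positivity) hi).2.1 (hm i)

lemma ml_tendsto_zero (α : ℝ) (hα : 0 < α) (h1 : α ≤ 1) :
    Tendsto (fun x : ℝ => mittagLeffler α (-x)) atTop (nhds 0) := by
  have hG : 0 < Real.Gamma (α + 1) := Real.Gamma_pos_of_pos (by positivity)
  have h : Tendsto (fun x : ℝ => (1 + x / Real.Gamma (α + 1))⁻¹) atTop (nhds 0) :=
    (tendsto_atTop_add_const_left _ 1 (tendsto_id.atTop_div_const hG)).inv_tendsto_atTop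
  refine tendsto_of_tendsto_of_tendsto_of_le_of_le' tendsto_const_nhds h ?_ ?_
  · filter_upwards [eventually_ge_atTop 0] with x hx
    exact (ml_nonneg_decay α hα h1 x hx).1
  · filter_upwards [eventually_ge_atTop 0] with x hx
    rw [← one_div, le_div_iff₀ (by positivity)]
    exact (ml_nonneg_decay α hα h1 x hx).2

noncomputable def mlC (α : ℝ) (z : ℂ) : ℂ := ∑' j : ℕ, z ^ j / (Real.Gamma (α * j + 1) : ℂ)

lemma mlC_ofReal (α x : ℝ) : mlC α (x : ℂ) = (mittagLeffler α x : ℂ) := by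
  unfold mlC mittagLeffler
  push_cast
  rfl

lemma mlC_differentiable (α : ℝ) (hα : 0 < α) : Differentiable ℂ (mlC α) := by
  intro z
  have hs := ml_summable α hα (‖z‖ + 1)
  have := Complex.differentiableOn_tsum_of_summable_norm (U := Metric.ball (0 : ℂ) (‖z‖ + 1))
    (F := fun (j : ℕ) (z : ℂ) => z ^ j / (Real.Gamma (α * j + 1) : ℂ)) hs
    (fun j => by fun_prop) Metric.isOpen_ball (by
      intro j w hw
      have hw : ‖w‖ < ‖z‖ + 1 := by simpa using hw
      have hG : 0 < Real.Gamma (α * j + 1) := Real.Gamma_pos_of_pos (by positivity)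
      rw [norm_div, norm_pow, Complex.norm_real, Real.norm_eq_abs, abs_of_pos hG]
      gcongr)
  exact this.differentiableAt (Metric.isOpen_ball.mem_nhds (by simp))

lemma ml_pos (α : ℝ) (hα : 0 < α) (h1 : α ≤ 1) (x : ℝ) (hx : 0 ≤ x) :
    0 < mittagLeffler α (-x) := by
  refine lt_of_le_of_ne (ml_nonneg_decay α hα h1 x hx).1 fun h0 => ?_
  have hz : ∀ y, x ≤ y → mittagLeffler α (-y) = 0 := fun y hy =>
    le_antisymm (h0 ▸ ml_antitone α hα h1 hx (hx.trans hy) hy)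
      (ml_nonneg_decay α hα h1 y (hx.trans hy)).1
  have han : AnalyticOnNhd ℂ (mlC α) univ := fun z _ => (mlC_differentiable α hα).analyticAt z
  have hfr : ∃ᶠ z in nhdsWithin (-(x : ℂ)) {-(x : ℂ)}ᶜ, mlC α z = 0 := by
    have ht : Tendsto (fun n : ℕ => -((x + 1 / ((n : ℝ) + 1) : ℝ) : ℂ)) atTop
        (nhdsWithin (-(x : ℂ)) {-(x : ℂ)}ᶜ) := by
      rw [tendsto_nhdsWithin_iff]
      constructor
      · have := (tendsto_one_div_add_atTop_nhds_zero_nat (𝕜 := ℝ)).const_add x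
        rw [add_zero] at this
        exact ((Complex.continuous_ofReal.tendsto x).comp this).neg
      · refine Eventually.of_forall fun n hn => ?_
        have hn : -((x + 1 / ((n : ℝ) + 1) : ℝ) : ℂ) = -(x : ℂ) := hn
        have hn := Complex.ofReal_injective (neg_injective hn)
        have : 0 < 1 / ((n : ℝ) + 1) := by positivity
        linarith
    refine ht.frequently (Eventually.frequently (Eventually.of_forall fun n => ?_))
    rw [← Complex.ofReal_neg, mlC_ofReal, hz, Complex.ofReal_zero]
    have : 0 < 1 / ((n : ℝ) + 1) := by positivity
    linarith
  have := han.eqOn_zero_of_preconnected_of_frequently_eq_zero isPreconnected_univ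
    (mem_univ _) hfr (mem_univ ((0 : ℝ) : ℂ))
  rw [mlC_ofReal, ml_zero] at this
  simp at this

lemma ml_matrix {n : ℕ} (α : ℝ) (hs : ∀ x : ℝ, Summable fun j : ℕ => x ^ j / Real.Gamma (α * j + 1))
    (A : Matrix (Fin n) (Fin n) ℝ) (hA : A.IsHermitian) (c : ℝ) :
    spectrum ℝ (mittagLefflerMatrix α (c • A)) =
      Set.range fun i => mittagLeffler α (c * hA.eigenvalues i) := by
  have key : mittagLefflerMatrix α (c • A) =
      Unitary.conjStarAlgAut ℝ _ hA.eigenvectorUnitary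
        (diagonal fun i => mittagLeffler α (c * hA.eigenvalues i)) := by
    have h1 : HasSum (fun j : ℕ => diagonal fun i : Fin n =>
        (c * hA.eigenvalues i) ^ j / Real.Gamma (α * j + 1))
        (diagonal fun i => mittagLeffler α (c * hA.eigenvalues i)) := by
      apply HasSum.matrix_diagonal
      rw [Pi.hasSum]
      intro i
      exact (hs _).hasSum
    have h2 := (h1.mul_left (hA.eigenvectorUnitary : Matrix (Fin n) (Fin n) ℝ)).mul_right
      (star (hA.eigenvectorUnitary : Matrix (Fin n) (Fin n) ℝ))
    rw [Unitary.conjStarAlgAut_apply, ← h2.tsum_eq]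
    unfold mittagLefflerMatrix
    congr 1
    ext1 j
    conv_lhs => rw [hA.spectral_theorem]
    rw [← Unitary.conjStarAlgAut_apply (S := ℝ), ← map_smul, ← map_pow, ← map_smul]
    congr 1
    rw [← diagonal_smul, diagonal_pow, ← diagonal_smul]
    congr 1
    ext i
    simp [div_eq_inv_mul]
  rw [key, AlgEquiv.spectrum_eq, spectrum_diagonal]

/-- for `0 < α ≤ 1`, `x ↦ E_α(-x)` equals `1` at `0`, is positive,
nonincreasing on `[0,∞)`, and tends to `0` at `∞`; consequently, for any real symmetric
positive semidefinite `A` and `t ≥ 0`, all eigenvalues of `E_α(-A tᵅ)` lie in `(0,1]`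
and this matrix is invertible. -/
theorem mittagLeffler_complete_monotone_and_matrix_invertible
    (α : ℝ) (hα : 0 < α) (hα1 : α ≤ 1) :
    mittagLeffler α 0 = 1 ∧
    (∀ x : ℝ, 0 ≤ x → 0 < mittagLeffler α (-x)) ∧
    AntitoneOn (fun x : ℝ => mittagLeffler α (-x)) (Ici 0) ∧
    Tendsto (fun x : ℝ => mittagLeffler α (-x)) atTop (nhds 0) ∧
    (∀ (n : ℕ) (A : Matrix (Fin n) (Fin n) ℝ), A.PosSemidef → ∀ t : ℝ, 0 ≤ t →
      (∀ μ : ℝ, Module.End.HasEigenvalue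
          (Matrix.toLin' (mittagLefflerMatrix α ((-(t ^ α)) • A))) μ → μ ∈ Ioc 0 1) ∧
      IsUnit (mittagLefflerMatrix α ((-(t ^ α)) • A))) := by
  refine ⟨ml_zero α, ml_pos α hα hα1, ml_antitone α hα hα1, ml_tendsto_zero α hα hα1, ?_⟩
  intro n A hA t ht
  have hsp := ml_matrix α (ml_summable α hα) A hA.isHermitian (-(t ^ α))
  have hmem : ∀ μ ∈ spectrum ℝ (mittagLefflerMatrix α ((-(t ^ α)) • A)), μ ∈ Ioc (0 : ℝ) 1 := by
    intro μ hμ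
    rw [hsp] at hμ
    obtain ⟨i, rfl⟩ := hμ
    have h0 : 0 ≤ t ^ α * hA.isHermitian.eigenvalues i :=
      mul_nonneg (Real.rpow_nonneg ht α) (hA.eigenvalues_nonneg i)
    beta_reduce
    rw [neg_mul]
    exact ⟨ml_pos α hα hα1 _ h0, ml_le_one α hα hα1 _ h0⟩
  constructor
  · intro μ hμ
    apply hmem
    rw [Module.End.hasEigenvalue_iff_mem_spectrum, Matrix.spectrum_toLin'] at hμ
    exact hμ
  · rw [← spectrum.zero_notMem_iff ℝ]
    intro h
    exact lt_irrefl _ (hmem 0 h).1
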